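/- arXiv:1507.08229 — 9 statements merged into one kernel-verified Lean document; each statement's English description precedes it below -/
import Mathlib

section
/- Let E be a real inner product space and M ⊆ E a set with 0 ∈ M. For any x ∈ E such that the set {⟪x, y⟫ | y ∈ M} is bounded above, the gauge (Minkowski functional) of the one-sided polar M° evaluated at x equals the support function of M at x: gauge M° x = sSup {⟪x, y⟫ | y ∈ M}. -/
open RealInnerProductSpace

theorem gauge_polar_eq_support
    {E : Type*} [NormedAddCommGroup E] [InnerProductSpace ℝ E]
    (M : Set E) (hM : (0 : E) ∈ M) (x : E)
    (hbdd : BddAbove {r : ℝ | ∃ y ∈ M, ⟪x, y⟫ = r}) :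
    gauge {x' : E | ∀ y ∈ M, ⟪x', y⟫ ≤ 1} x = sSup {r : ℝ | ∃ y ∈ M, ⟪x, y⟫ = r} := by
  set S := {r : ℝ | ∃ y ∈ M, ⟪x, y⟫ = r} with hS
  have hzero : (0 : ℝ) ∈ S := ⟨0, hM, inner_zero_right x⟩
  have hnonneg : 0 ≤ sSup S := le_csSup hbdd hzero
  have hmem (r : ℝ) (hr : 0 < r) :
      r⁻¹ • x ∈ {x' : E | ∀ y ∈ M, ⟪x', y⟫ ≤ 1} ↔ sSup S ≤ r := by
    rw [csSup_le_iff hbdd ⟨0, hzero⟩]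
    simp [hS, real_inner_smul_left, inv_mul_le_iff₀ hr]
  rw [gauge_def']
  apply le_antisymm
  · refine le_of_forall_pos_le_add fun ε hε => csInf_le ⟨0, fun r hr => hr.1.le⟩ ?_
    have hpos : 0 < sSup S + ε := by positivity
    exact ⟨hpos, (hmem _ hpos).2 (by linarith)⟩
  · have hpos : 0 < sSup S + 1 := by positivity
    refine le_csInf ⟨sSup S + 1, hpos, (hmem _ hpos).2 (by linarith)⟩ ?_
    exact fun r hr => (hmem r hr.1).1 hr.2
end

section
/- Let E = EuclideanSpace ℝ (Fin n) and let M, N ⊆ E be closed convex sets with 0 ∈ M and 0 ∈ N. Then the one-sided polar of their intersection equals the closed convex hull of the union of their one-sided polars: (M ∩ N)° = closure (convexHull ℝ (M° ∪ N°)). -/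
open RealInnerProductSpace

/-- The one-sided polar of a set in a real inner product space. -/
def onePolar {E : Type*} [NormedAddCommGroup E] [InnerProductSpace ℝ E] (M : Set E) : Set E :=
  {x : E | ∀ y ∈ M, ⟪x, y⟫ ≤ 1}

section onePolar

variable {E : Type*} [NormedAddCommGroup E] [InnerProductSpace ℝ E]

theorem onePolar_anti {M N : Set E} (h : M ⊆ N) : onePolar N ⊆ onePolar M :=
  fun _ hx y hy => hx y (h hy)

theorem zero_mem_onePolar (M : Set E) : (0 : E) ∈ onePolar M :=
  fun y _ => by simp

theorem onePolar_eq_iInter (M : Set E) : onePolar M = ⋂ y ∈ M, {x : E | ⟪x, y⟫ ≤ 1} := by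
  ext x
  simp [onePolar]

theorem isClosed_onePolar (M : Set E) : IsClosed (onePolar M) := by
  rw [onePolar_eq_iInter]
  exact isClosed_biInter fun y _ => isClosed_le (by fun_prop) continuous_const

theorem convex_onePolar (M : Set E) : Convex ℝ (onePolar M) := by
  rw [onePolar_eq_iInter]
  refine convex_iInter₂ fun y _ => ?_
  simp_rw [real_inner_comm y]
  exact convex_halfSpace_le (innerSL ℝ y).isLinear 1

/-- A point outside a closed convex set containing the origin is separated from it by a vector
of the one-sided polar. -/
theorem exists_mem_onePolar_one_lt_inner [CompleteSpace E] {K : Set E} (hKc : IsClosed K)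
    (hK : Convex ℝ K) (hK0 : (0 : E) ∈ K) {x : E} (hx : x ∉ K) :
    ∃ p ∈ onePolar K, 1 < ⟪p, x⟫ := by
  obtain ⟨f, u, hf, hu⟩ := geometric_hahn_banach_closed_point hK hKc hx
  have hu0 : 0 < u := by simpa using hf 0 hK0
  refine ⟨u⁻¹ • (InnerProductSpace.toDual ℝ E).symm f, fun y hy => ?_, ?_⟩
  · rw [real_inner_smul_left, InnerProductSpace.toDual_symm_apply, inv_mul_le_iff₀ hu0, mul_one]
    exact (hf y hy).le
  · rwa [real_inner_smul_left, InnerProductSpace.toDual_symm_apply, lt_inv_mul_iff₀ hu0, mul_one]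

/-- The bipolar theorem, in the nontrivial direction. -/
theorem onePolar_onePolar_subset [CompleteSpace E] {K : Set E} (hKc : IsClosed K)
    (hK : Convex ℝ K) (hK0 : (0 : E) ∈ K) : onePolar (onePolar K) ⊆ K := by
  intro x hx
  by_contra hxK
  obtain ⟨p, hp, hpx⟩ := exists_mem_onePolar_one_lt_inner hKc hK hK0 hxK
  rw [real_inner_comm] at hpx
  exact (hx p hp).not_gt hpx

end onePolar

theorem polar_inter (n : ℕ) (M N : Set (EuclideanSpace ℝ (Fin n)))
    (hMc : IsClosed M) (hMconv : Convex ℝ M) (hM0 : (0 : EuclideanSpace ℝ (Fin n)) ∈ M)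
    (hNc : IsClosed N) (hNconv : Convex ℝ N) (hN0 : (0 : EuclideanSpace ℝ (Fin n)) ∈ N) :
    onePolar (M ∩ N) = closure (convexHull ℝ (onePolar M ∪ onePolar N)) := by
  set C := closure (convexHull ℝ (onePolar M ∪ onePolar N))
  have hC : onePolar M ∪ onePolar N ⊆ C := (subset_convexHull ℝ _).trans subset_closure
  refine Set.Subset.antisymm ?_ ?_
  · have hCM : onePolar C ⊆ M :=
      (onePolar_anti (Set.subset_union_left.trans hC)).trans
        (onePolar_onePolar_subset hMc hMconv hM0)
    have hCN : onePolar C ⊆ N :=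
      (onePolar_anti (Set.subset_union_right.trans hC)).trans
        (onePolar_onePolar_subset hNc hNconv hN0)
    exact (onePolar_anti (Set.subset_inter hCM hCN)).trans
      (onePolar_onePolar_subset isClosed_closure (convex_convexHull ℝ _).closure
        (hC (Or.inl (zero_mem_onePolar M))))
  · exact closure_minimal
      (convexHull_min
        (Set.union_subset (onePolar_anti Set.inter_subset_left)
          (onePolar_anti Set.inter_subset_right))
        (convex_onePolar _))
      (isClosed_onePolar _)
end

section
/- Let E = EuclideanSpace ℝ (Fin n) and M ⊆ E a closed convex set with 0 ∈ M. Then M is absorbent (for every y ∈ E there exists ε > 0 with ε • y ∈ M) if and only if its one-sided polar M° is bounded. -/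
open RealInnerProductSpace

section

variable {E : Type*} [NormedAddCommGroup E] [InnerProductSpace ℝ E] [CompleteSpace E] {M : Set E}

/-- The polar of an absorbent set in a Hilbert space is bounded, by the uniform boundedness
principle. -/
theorem isBounded_onePolar (h : ∀ y : E, ∃ ε : ℝ, 0 < ε ∧ ε • y ∈ M) :
    Bornology.IsBounded (onePolar M) := by
  have upper : ∀ y : E, ∃ C : ℝ, ∀ x ∈ onePolar M, ⟪x, y⟫ ≤ C := by
    intro y
    obtain ⟨ε, hε, hy⟩ := h y
    refine ⟨1 / ε, fun x hx ↦ ?_⟩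
    have hxy := hx _ hy
    rw [inner_smul_right] at hxy
    rwa [le_div_iff₀' hε]
  have pointwise : ∀ y : E, ∃ C, ∀ x : onePolar M, ‖innerSL ℝ (x : E) y‖ ≤ C := by
    intro y
    obtain ⟨C, hC⟩ := upper y
    obtain ⟨D, hD⟩ := upper (-y)
    refine ⟨max C D, fun x ↦ ?_⟩
    have hDx := hD x x.2
    rw [inner_neg_right] at hDx
    rw [innerSL_apply_apply, Real.norm_eq_abs]
    exact abs_le.2 ⟨by linarith [le_max_right C D], (hC x x.2).trans (le_max_left C D)⟩
  obtain ⟨C, hC⟩ := banach_steinhaus pointwise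
  refine isBounded_iff_forall_norm_le.2 ⟨C, fun x hx ↦ ?_⟩
  simpa using hC ⟨x, hx⟩

/-- A closed convex set containing `0` whose polar lies in the ball of radius `R` contains the
ball of radius `1 / R`. -/
theorem mem_of_onePolar_norm_le (hMc : IsClosed M) (hMconv : Convex ℝ M) (hM0 : (0 : E) ∈ M)
    {R : ℝ} (hR : ∀ x ∈ onePolar M, ‖x‖ ≤ R) {z : E} (hz : R * ‖z‖ ≤ 1) : z ∈ M := by
  by_contra hzM
  obtain ⟨f, u, hfM, hfz⟩ := geometric_hahn_banach_closed_point hMconv hMc hzM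
  have hu : 0 < u := by simpa using hfM 0 hM0
  let x : E := u⁻¹ • (InnerProductSpace.toDual ℝ E).symm f
  have hx : ∀ y, ⟪x, y⟫ = f y / u := fun y ↦ by
    simp [x, real_inner_smul_left, div_eq_inv_mul]
  have hxM : x ∈ onePolar M := fun y hy ↦ by
    rw [hx, div_le_one hu]
    exact (hfM y hy).le
  have hxz : 1 < ⟪x, z⟫ := by rwa [hx, one_lt_div hu]
  have hle : ⟪x, z⟫ ≤ R * ‖z‖ :=
    (real_inner_le_norm x z).trans (by gcongr; exact hR x hxM)
  linarith

end

theorem absorbent_iff_polar_bounded (n : ℕ) (M : Set (EuclideanSpace ℝ (Fin n)))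
    (hMc : IsClosed M) (hMconv : Convex ℝ M) (hM0 : (0 : EuclideanSpace ℝ (Fin n)) ∈ M) :
    (∀ y : EuclideanSpace ℝ (Fin n), ∃ ε : ℝ, 0 < ε ∧ ε • y ∈ M) ↔
      Bornology.IsBounded (onePolar M) := by
  refine ⟨isBounded_onePolar, fun h y ↦ ?_⟩
  obtain ⟨R, hRpos, hR⟩ := h.exists_pos_norm_le
  have hpos : 0 < R * ‖y‖ + 1 := by positivity
  refine ⟨(R * ‖y‖ + 1)⁻¹, inv_pos.2 hpos, mem_of_onePolar_norm_le hMc hMconv hM0 hR ?_⟩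
  rw [norm_smul, Real.norm_of_nonneg (inv_pos.2 hpos).le, mul_left_comm, inv_mul_le_one₀ hpos]
  linarith
end

section
/- Let E = EuclideanSpace ℝ (Fin n) and M ⊆ E a compact convex set with 0 in the interior of M. Then for every x ∈ E, the support function of −M ∩ M at x equals the infimal convolution of the support function of M with itself in the sense: sSup {⟪x, y⟫ | y ∈ −M ∩ M} = ⨅ z ∈ E, (sSup {⟪z, y⟫ | y ∈ M} + sSup {⟪z − x, y⟫ | y ∈ M}), and this infimum is attained. -/
open RealInnerProductSpace

section SupportFunction

variable {E : Type*} [NormedAddCommGroup E] [InnerProductSpace ℝ E]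

theorem IsCompact.bddAbove_inner {M : Set E} (hM : IsCompact M) (z : E) :
    BddAbove {r : ℝ | ∃ y ∈ M, ⟪z, y⟫ = r} :=
  hM.bddAbove_image (f := fun y => ⟪z, y⟫) (by fun_prop)

theorem support_inter_neg_le_add {M : Set E} (hM : IsCompact M) (h0 : (0 : E) ∈ M) (x z : E) :
    sSup {r : ℝ | ∃ y ∈ (-M ∩ M), ⟪x, y⟫ = r} ≤
      sSup {r : ℝ | ∃ y ∈ M, ⟪z, y⟫ = r} + sSup {r : ℝ | ∃ y ∈ M, ⟪z - x, y⟫ = r} := by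
  refine csSup_le ⟨_, 0, ⟨by simpa using h0, h0⟩, rfl⟩ ?_
  rintro _ ⟨y, ⟨hy', hy⟩, rfl⟩
  have h1 := le_csSup (hM.bddAbove_inner z) ⟨y, hy, rfl⟩
  have h2 := le_csSup (hM.bddAbove_inner (z - x)) ⟨-y, hy', rfl⟩
  have h3 : ⟪x, y⟫ = ⟪z, y⟫ + ⟪z - x, -y⟫ := by
    rw [inner_neg_right, inner_sub_left]; ring
  linarith

/-- A vector separating the sums `a + b` of interior points from the bound `m + ⟪x, b⟫`. -/
theorem Convex.exists_inner_add_inner_le_of_interior [CompleteSpace E] {M : Set E}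
    (hM : Convex ℝ M) (h0 : (0 : E) ∈ interior M) (x : E) {m : ℝ}
    (hm : ∀ y ∈ -M ∩ M, ⟪x, y⟫ ≤ m) :
    ∃ z : E, ∀ a ∈ interior M, ∀ b ∈ interior M, ⟪z, a⟫ + ⟪z - x, b⟫ ≤ m := by
  let U : Set ((E × E) × ℝ) :=
    (interior M ×ˢ interior M) ×ˢ Set.univ ∩ {p | m + ⟪x, p.1.2⟫ < p.2}
  let L : (E × E) × ℝ →L[ℝ] E × ℝ :=
    ((ContinuousLinearMap.fst ℝ E E + ContinuousLinearMap.snd ℝ E E).prodMap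
      (ContinuousLinearMap.id ℝ ℝ))
  have hL : Function.Surjective L := fun p => ⟨((p.1, 0), p.2), by simp [L]⟩
  have hUo : IsOpen U :=
    ((isOpen_interior.prod isOpen_interior).prod isOpen_univ).inter
      (isOpen_lt (by fun_prop) (by fun_prop))
  have hUc : Convex ℝ U := by
    refine ((hM.interior.prod hM.interior).prod convex_univ).inter ?_
    intro p hp q hq s t hs ht hst
    simp only [Set.mem_ofPred_eq, Prod.fst_add, Prod.snd_add, Prod.smul_fst, Prod.smul_snd,
      inner_add_right, inner_smul_right, smul_eq_mul] at hp hq ⊢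
    have ht' : t = 1 - s := by linarith
    subst ht'
    rcases hs.eq_or_lt with rfl | hs
    · linarith
    · nlinarith [mul_lt_mul_of_pos_left hp hs, mul_le_mul_of_nonneg_left hq.le ht]
  have hnot : (0 : E × ℝ) ∉ L '' U := by
    rintro ⟨⟨⟨a, b⟩, t⟩, ⟨⟨⟨ha, hb⟩, -⟩, ht⟩, h⟩
    obtain ⟨hab, rfl⟩ : a + b = 0 ∧ t = 0 := Prod.mk_eq_zero.1 h
    obtain rfl : a = -b := eq_neg_of_add_eq_zero_left hab
    have := hm (-b) ⟨by simpa using interior_subset hb, interior_subset ha⟩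
    rw [inner_neg_right] at this
    simp only [Set.mem_ofPred_eq] at ht
    linarith
  obtain ⟨f, hf⟩ := geometric_hahn_banach_open_point (hUc.is_linear_image L.isLinear)
    (L.isOpenMap hL U hUo) hnot
  have hsplit (v : E) (t : ℝ) : f (v, t) = f (v, 0) + t * f (0, 1) := by
    rw [← smul_eq_mul, ← map_smul, ← map_add]; simp
  have key : ∀ a ∈ interior M, ∀ b ∈ interior M, ∀ t, m + ⟪x, b⟫ < t →
      f (a + b, 0) + t * f (0, 1) < 0 := by
    intro a ha b hb t ht
    have := hf (L ((a, b), t)) ⟨_, ⟨⟨⟨ha, hb⟩, trivial⟩, ht⟩, rfl⟩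
    rw [map_zero] at this
    rw [← hsplit]
    simpa [L] using this
  set c := f (0, 1) with hc
  have hcneg : c < 0 := by
    have := key 0 h0 0 h0 (|m| + 1) (by simp; linarith [le_abs_self m])
    have h00 : f ((0 : E) + 0, (0 : ℝ)) = 0 := by
      rw [add_zero]; exact map_zero f
    rw [h00, zero_add] at this
    exact neg_of_mul_neg_right this (by positivity)
  let l : StrongDual ℝ E := (-c)⁻¹ • f.comp (ContinuousLinearMap.inl ℝ E ℝ)
  refine ⟨(InnerProductSpace.toDual ℝ E).symm l, fun a ha b hb => ?_⟩
  have hl : l (a + b) ≤ m + ⟪x, b⟫ := by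
    refine le_of_forall_gt fun t ht => ?_
    have := key a ha b hb t ht
    change (-c)⁻¹ * f (a + b, 0) < t
    rw [inv_mul_lt_iff₀ (by linarith)]
    linarith
  rw [inner_sub_left, InnerProductSpace.toDual_symm_apply, InnerProductSpace.toDual_symm_apply]
  rw [map_add] at hl
  linarith

theorem Convex.exists_inner_add_inner_le [CompleteSpace E] {M : Set E}
    (hM : Convex ℝ M) (h0 : (0 : E) ∈ interior M) (x : E) {m : ℝ}
    (hm : ∀ y ∈ -M ∩ M, ⟪x, y⟫ ≤ m) :
    ∃ z : E, ∀ a ∈ M, ∀ b ∈ M, ⟪z, a⟫ + ⟪z - x, b⟫ ≤ m := by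
  obtain ⟨z, hz⟩ := hM.exists_inner_add_inner_le_of_interior h0 x hm
  have hcl : M ⊆ closure (interior M) := by
    rw [hM.closure_interior_eq_closure_of_nonempty_interior ⟨0, h0⟩]
    exact subset_closure
  refine ⟨z, fun a ha b hb => ?_⟩
  have hab : (a, b) ∈ closure (interior M ×ˢ interior M) := by
    rw [closure_prod_eq]
    exact ⟨hcl ha, hcl hb⟩
  exact le_on_closure (f := fun p : E × E => ⟪z, p.1⟫ + ⟪z - x, p.2⟫) (g := fun _ => m)
    (fun p hp => hz p.1 hp.1 p.2 hp.2) (by fun_prop) (by fun_prop) hab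

theorem exists_support_add_le_support_inter_neg [CompleteSpace E] {M : Set E}
    (hMc : IsCompact M) (hM : Convex ℝ M) (h0 : (0 : E) ∈ interior M) (x : E) :
    ∃ z : E, sSup {r : ℝ | ∃ y ∈ M, ⟪z, y⟫ = r} + sSup {r : ℝ | ∃ y ∈ M, ⟪z - x, y⟫ = r} ≤
      sSup {r : ℝ | ∃ y ∈ (-M ∩ M), ⟪x, y⟫ = r} := by
  have h0' : (0 : E) ∈ M := interior_subset h0
  obtain ⟨z, hz⟩ := hM.exists_inner_add_inner_le h0 x
    (m := sSup {r : ℝ | ∃ y ∈ (-M ∩ M), ⟪x, y⟫ = r}) fun y hy =>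
      le_csSup ((hMc.bddAbove_inner x).mono (by rintro _ ⟨w, hw, h⟩; exact ⟨w, hw.2, h⟩))
        ⟨y, hy, rfl⟩
  refine ⟨z, ?_⟩
  rw [← le_sub_iff_add_le]
  refine csSup_le ⟨_, 0, h0', rfl⟩ ?_
  rintro _ ⟨a, ha, rfl⟩
  rw [le_sub_comm]
  refine csSup_le ⟨_, 0, h0', rfl⟩ ?_
  rintro _ ⟨b, hb, rfl⟩
  linarith [hz a ha b hb]

end SupportFunction

theorem support_inter_eq_infConv (n : ℕ) (M : Set (EuclideanSpace ℝ (Fin n)))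
    (hMc : IsCompact M) (hMconv : Convex ℝ M)
    (h0 : (0 : EuclideanSpace ℝ (Fin n)) ∈ interior M) (x : EuclideanSpace ℝ (Fin n)) :
    (sSup {r : ℝ | ∃ y ∈ (-M ∩ M), ⟪x, y⟫ = r} =
        ⨅ z : EuclideanSpace ℝ (Fin n),
          (sSup {r : ℝ | ∃ y ∈ M, ⟪z, y⟫ = r} + sSup {r : ℝ | ∃ y ∈ M, ⟪z - x, y⟫ = r})) ∧
      ∃ z : EuclideanSpace ℝ (Fin n),
        sSup {r : ℝ | ∃ y ∈ (-M ∩ M), ⟪x, y⟫ = r} =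
          sSup {r : ℝ | ∃ y ∈ M, ⟪z, y⟫ = r} + sSup {r : ℝ | ∃ y ∈ M, ⟪z - x, y⟫ = r} := by
  have hle := support_inter_neg_le_add hMc (interior_subset h0) x
  obtain ⟨z, hz⟩ := exists_support_add_le_support_inter_neg hMc hMconv h0 x
  refine ⟨le_antisymm (le_ciInf hle) ?_, z, le_antisymm (hle z) hz⟩
  exact (ciInf_le ⟨_, Set.forall_mem_range.2 hle⟩ z).trans hz
end

section
/- Let E be a real inner product space and F : E → ℝ strictly convex (StrictConvexOn ℝ Set.univ F). If y ≠ z, then ∂F(y) and ∂F(z) are disjoint: no x ∈ E is a subgradient of F at both y and z. Consequently the distance D_F separates points of E. -/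
open RealInnerProductSpace

/-- The subdifferential of `F : E → ℝ` at `z`. -/
def subdiff {E : Type*} [NormedAddCommGroup E] [InnerProductSpace ℝ E]
    (F : E → ℝ) (z : E) : Set E :=
  {x : E | ∀ w : E, ⟪x, w - z⟫ ≤ F w - F z}

theorem subdiff_disjoint_of_strictConvex
    {E : Type*} [NormedAddCommGroup E] [InnerProductSpace ℝ E]
    (F : E → ℝ) (hF : StrictConvexOn ℝ Set.univ F) (y z : E) (hyz : y ≠ z) :
    ∀ x : E, ¬ (x ∈ subdiff F y ∧ x ∈ subdiff F z) := by
  rintro x ⟨hy, hz⟩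
  have hlt := hF.2 (Set.mem_univ y) (Set.mem_univ z) hyz
    (by norm_num : (0 : ℝ) < 1 / 2) (by norm_num : (0 : ℝ) < 1 / 2) (by norm_num)
  have h₁ := hy ((1 / 2 : ℝ) • y + (1 / 2 : ℝ) • z)
  have h₂ := hz ((1 / 2 : ℝ) • y + (1 / 2 : ℝ) • z)
  simp only [inner_sub_right, inner_add_right, real_inner_smul_right] at h₁ h₂
  simp only [smul_eq_mul] at hlt
  linarith
end

section
/- (Integral form of the generalized law of cosines) Let E be a real Banach space, F : E → ℝ with Fréchet derivative f : E → (E →L[ℝ] ℝ) (HasFDerivAt F (f x) x for all x) and second derivative f'' : E → (E →L[ℝ] E →L[ℝ] ℝ) (HasFDerivAt f (f'' x) x for all x), with f'' continuous. Then for all y, z ∈ E: F y − F z − f z (y − z) = ∫ t in (0:ℝ)..1, (1 − t) * (f'' (z + t • (y − z)) (y − z) (y − z)). -/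
theorem bregman_integral_remainder
    {E : Type*} [NormedAddCommGroup E] [NormedSpace ℝ E] [CompleteSpace E]
    (F : E → ℝ) (f : E → (E →L[ℝ] ℝ)) (f'' : E → (E →L[ℝ] E →L[ℝ] ℝ))
    (hf : ∀ x : E, HasFDerivAt F (f x) x)
    (hf'' : ∀ x : E, HasFDerivAt f (f'' x) x)
    (hcont : Continuous f'') (y z : E) :
    F y - F z - f z (y - z) =
      ∫ t in (0:ℝ)..1, (1 - t) * (f'' (z + t • (y - z)) (y - z) (y - z)) := by
  have hline (t : ℝ) : HasDerivAt (fun s : ℝ => z + s • (y - z)) (y - z) t := by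
    simpa using ((hasDerivAt_id t).smul_const (y - z)).const_add z
  have hderiv (t : ℝ) : HasDerivAt
      (fun s : ℝ => F (z + s • (y - z)) + (1 - s) * f (z + s • (y - z)) (y - z))
      ((1 - t) * f'' (z + t • (y - z)) (y - z) (y - z)) t := by
    have hF := (hf _).comp_hasDerivAt t (hline t)
    have hfv := ((hf'' _).comp_hasDerivAt t (hline t)).clm_apply (hasDerivAt_const t (y - z))
    refine (hF.add (((hasDerivAt_id t).const_sub 1).mul hfv)).congr_deriv ?_
    simp [-map_sub]
  have hint : Continuous fun t : ℝ =>
      (1 - t) * f'' (z + t • (y - z)) (y - z) (y - z) := by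
    fun_prop
  rw [intervalIntegral.integral_eq_sub_of_hasDerivAt (fun t _ => hderiv t)
    (hint.intervalIntegrable 0 1)]
  simp [sub_sub]
end

section
/- For every x : ℝ, the value Real.exp x − 1 − x is the greatest element of the set {x * u − ((1 + u) * Real.log (1 + u) − u) | u : ℝ, u > −1}; that is, φ*(x) = e^x − 1 − x is the Legendre–Fenchel conjugate of φ(u) = (1+u)ln(1+u) − u, with the supremum attained at u = Real.exp x − 1. -/
theorem phiStar_is_conjugate_of_phi (x : ℝ) :
    IsGreatest {v : ℝ | ∃ u : ℝ, u > -1 ∧ x * u - ((1 + u) * Real.log (1 + u) - u) = v}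
      (Real.exp x - 1 - x) ∧
    x * (Real.exp x - 1) -
        ((1 + (Real.exp x - 1)) * Real.log (1 + (Real.exp x - 1)) - (Real.exp x - 1)) =
      Real.exp x - 1 - x := by
  have attained : x * (Real.exp x - 1) -
      ((1 + (Real.exp x - 1)) * Real.log (1 + (Real.exp x - 1)) - (Real.exp x - 1)) =
      Real.exp x - 1 - x := by
    rw [add_sub_cancel, Real.log_exp]
    ring
  refine ⟨⟨⟨Real.exp x - 1, by linarith [Real.exp_pos x], attained⟩, ?_⟩, attained⟩
  rintro _ ⟨u, hu, rfl⟩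
  have hpos : 0 < 1 + u := by linarith
  have tangent := mul_le_mul_of_nonneg_left
    (Real.add_one_le_exp (x - Real.log (1 + u))) hpos.le
  rw [Real.exp_sub, Real.exp_log hpos, mul_div_cancel₀ _ hpos.ne'] at tangent
  linarith
end

section
/- For every t : ℝ with 0 ≤ t < 1, one has (1 + t) * Real.log (1 + t) − t ≤ (1 − t) * Real.log (1 − t) + t; that is, φ(|u|) ≤ φ(−|u|) for the function φ(u) = (1+u)ln(1+u) − u, expressing that φ is not even and its reflection dominates it on [0,1). -/
/-- The difference of the two sides has derivative `-log (1 - x) - log (1 + x)`. -/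
theorem hasDerivAt_phi_neg_sub_phi {x : ℝ} (h₁ : 1 - x ≠ 0) (h₂ : 1 + x ≠ 0) :
    HasDerivAt
      (fun s : ℝ => (1 - s) * Real.log (1 - s) + s - ((1 + s) * Real.log (1 + s) - s))
      (-Real.log (1 - x) - Real.log (1 + x)) x := by
  have hs : HasDerivAt (fun s : ℝ => 1 - s) (-1) x := (hasDerivAt_id x).const_sub 1
  have ha : HasDerivAt (fun s : ℝ => 1 + s) 1 x := (hasDerivAt_id x).const_add 1
  refine (((hs.mul (hs.log h₁)).add (hasDerivAt_id x)).sub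
    ((ha.mul (ha.log h₂)).sub (hasDerivAt_id x))).congr_deriv ?_
  field_simp
  ring

theorem monotoneOn_phi_neg_sub_phi :
    MonotoneOn
      (fun s : ℝ => (1 - s) * Real.log (1 - s) + s - ((1 + s) * Real.log (1 + s) - s))
      (Set.Ico 0 1) := by
  have hderiv : ∀ x ∈ Set.Ico (0 : ℝ) 1, HasDerivAt
      (fun s : ℝ => (1 - s) * Real.log (1 - s) + s - ((1 + s) * Real.log (1 + s) - s))
      (-Real.log (1 - x) - Real.log (1 + x)) x := fun x hx =>
    hasDerivAt_phi_neg_sub_phi (by linarith [hx.2]) (by linarith [hx.1])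
  refine monotoneOn_of_hasDerivWithinAt_nonneg (convex_Ico 0 1)
    (fun x hx => (hderiv x hx).continuousAt.continuousWithinAt)
    (fun x hx => (hderiv x (interior_subset hx)).hasDerivWithinAt) fun x hx => ?_
  obtain ⟨h0, h1⟩ := interior_subset hx
  have hsub := Real.log_le_sub_one_of_pos (show 0 < 1 - x by linarith)
  have hadd := Real.log_le_sub_one_of_pos (show 0 < 1 + x by linarith)
  linarith

theorem phi_abs_le_phi_neg_abs (t : ℝ) (ht0 : 0 ≤ t) (ht1 : t < 1) :
    (1 + t) * Real.log (1 + t) - t ≤ (1 - t) * Real.log (1 - t) + t := by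
  have h := monotoneOn_phi_neg_sub_phi ⟨le_rfl, zero_lt_one⟩ ⟨ht0, ht1⟩ ht0
  simpa using h
end

section
/- (Asplund–Rockafellar / Moreau) Let E = EuclideanSpace ℝ (Fin n) and let F : E → EReal be proper (never ⊥, not identically ⊤), convex, and lower semicontinuous. Define the conjugate F* : E → EReal by F*(x) = ⨆ y, ((⟪x, y⟫ : EReal) − F y). If 0 lies in the interior of {x | F* x ≠ ⊤}, then for every λ : ℝ the sublevel set {y | F y ≤ (λ : EReal)} is bounded. Conversely, if for some λ : ℝ with (λ : EReal) > ⨅ y, F y the sublevel set {y | F y ≤ (λ : EReal)} is nonempty and bounded, then 0 lies in the interior of {x | F* x ≠ ⊤}. -/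
open RealInnerProductSpace

/-- A lower semicontinuous function that avoids `⊥` is bounded below by a real number on each
compact set. -/
lemma LowerSemicontinuous.exists_real_le_of_isCompact {E : Type*} [TopologicalSpace E]
    {F : E → EReal} (hF : LowerSemicontinuous F) (hbot : ∀ y, F y ≠ ⊥) {K : Set E}
    (hK : IsCompact K) : ∃ m : ℝ, ∀ y ∈ K, (m : EReal) ≤ F y := by
  rcases K.eq_empty_or_nonempty with rfl | hne
  · exact ⟨0, by simp⟩
  · obtain ⟨a, -, hmin⟩ := (hF.lowerSemicontinuousOn K).exists_isMinOn hne hK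
    obtain ⟨m, -, hm⟩ := EReal.lt_iff_exists_real_btwn.1 (bot_lt_iff_ne_bot.2 (hbot a))
    exact ⟨m, fun y hy => hm.le.trans (hmin hy)⟩

/-- If a convex function has a bounded sublevel set at a height above its value at `y₀`,
then it grows at least linearly in the distance from `y₀`, outside some ball. -/
lemma exists_linear_growth_of_isBounded_sublevel {E : Type*} [NormedAddCommGroup E]
    [NormedSpace ℝ E] {F : E → EReal} (hbot : ∀ y, F y ≠ ⊥)
    (hconv : ∀ y z : E, ∀ a b : ℝ, 0 ≤ a → 0 ≤ b → a + b = 1 →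
      F (a • y + b • z) ≤ (a : EReal) * F y + (b : EReal) * F z)
    {lam m₀ : ℝ} {y₀ : E} (hy₀ : F y₀ = (m₀ : EReal)) (hlt : m₀ < lam)
    (hbdd : Bornology.IsBounded {y | F y ≤ (lam : EReal)}) :
    ∃ c > 0, ∃ r > 0, ∀ y, r < ‖y - y₀‖ → ((m₀ + c * ‖y - y₀‖ : ℝ) : EReal) ≤ F y := by
  obtain ⟨r, hr, hsub⟩ := hbdd.subset_ball_lt 0 y₀
  refine ⟨(lam - m₀) / r, div_pos (sub_pos.2 hlt) hr, r, hr, fun y hy => ?_⟩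
  have hd : 0 < ‖y - y₀‖ := hr.trans hy
  set t : ℝ := r / ‖y - y₀‖ with ht
  have ht0 : 0 < t := div_pos hr hd
  have ht1 : t ≤ 1 := (div_le_one hd).2 hy.le
  have hz : ((lam : ℝ) : EReal) < F ((1 - t) • y₀ + t • y) := by
    by_contra! hle
    have hmem := hsub (show (1 - t) • y₀ + t • y ∈ {y | F y ≤ (lam : EReal)} from hle)
    rw [Metric.mem_ball, dist_eq_norm,
      show (1 - t) • y₀ + t • y - y₀ = t • (y - y₀) by module, norm_smul,
      Real.norm_of_nonneg ht0.le, ht, div_mul_cancel₀ _ hd.ne'] at hmem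
    exact lt_irrefl _ hmem
  have hle := hz.trans_le (hconv y₀ y (1 - t) t (by linarith) ht0.le (by ring))
  rw [hy₀] at hle
  induction hFy : F y with
  | bot => exact absurd hFy (hbot y)
  | top => exact le_top
  | coe v =>
    rw [hFy] at hle
    norm_cast at hle ⊢
    have hc : (lam - m₀) / r * ‖y - y₀‖ = (lam - m₀) / t := by
      rw [ht]; field_simp
    rw [hc, ← le_sub_iff_add_le', div_le_iff₀ ht0]
    nlinarith

/-- In a proper space, a lower semicontinuous convex function with a bounded sublevel set above
its infimum dominates a function `M + c * ‖y - y₀‖` with positive slope. -/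
lemma exists_norm_minorant_of_isBounded_sublevel {E : Type*} [NormedAddCommGroup E]
    [NormedSpace ℝ E] [ProperSpace E] {F : E → EReal} (hbot : ∀ y, F y ≠ ⊥)
    (hconv : ∀ y z : E, ∀ a b : ℝ, 0 ≤ a → 0 ≤ b → a + b = 1 →
      F (a • y + b • z) ≤ (a : EReal) * F y + (b : EReal) * F z)
    (hlsc : LowerSemicontinuous F) {lam : ℝ} (hlam : ⨅ y, F y < (lam : EReal))
    (hbdd : Bornology.IsBounded {y | F y ≤ (lam : EReal)}) :
    ∃ c > 0, ∃ (M : ℝ) (y₀ : E), ∀ y, ((M + c * ‖y - y₀‖ : ℝ) : EReal) ≤ F y := by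
  obtain ⟨y₀, hlt⟩ := iInf_lt_iff.1 hlam
  obtain ⟨m₀, hm₀⟩ : ∃ m₀ : ℝ, F y₀ = m₀ :=
    ⟨_, (EReal.coe_toReal hlt.ne_top (hbot y₀)).symm⟩
  rw [hm₀, EReal.coe_lt_coe_iff] at hlt
  obtain ⟨c, hc, r, hr, hgrow⟩ :=
    exists_linear_growth_of_isBounded_sublevel hbot hconv hm₀ hlt hbdd
  obtain ⟨m, hm⟩ := hlsc.exists_real_le_of_isCompact hbot (isCompact_closedBall y₀ r)
  refine ⟨c, hc, min m₀ (m - c * r), y₀, fun y => ?_⟩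
  rcases le_or_gt ‖y - y₀‖ r with h | h
  · refine le_trans ?_ (hm y (by rwa [Metric.mem_closedBall, dist_eq_norm]))
    rw [EReal.coe_le_coe_iff]
    have := min_le_right m₀ (m - c * r)
    nlinarith
  · refine le_trans ?_ (hgrow y h)
    rw [EReal.coe_le_coe_iff]
    gcongr
    exact min_le_left _ _

/-- A linear functional at which the conjugate is not `⊤` is bounded above on every sublevel
set. -/
lemma exists_inner_le_of_conjugate_ne_top {E : Type*} [NormedAddCommGroup E]
    [InnerProductSpace ℝ E] {F : E → EReal} (hbot : ∀ y, F y ≠ ⊥) {x : E}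
    (hx : (⨆ y, ((⟪x, y⟫ : EReal) - F y)) ≠ ⊤) (lam : ℝ) :
    ∃ C : ℝ, ∀ y, F y ≤ (lam : EReal) → ⟪x, y⟫ ≤ C := by
  obtain ⟨C, hC, -⟩ := EReal.lt_iff_exists_real_btwn.1 (lt_top_iff_ne_top.2 hx)
  refine ⟨C + lam, fun y hy => ?_⟩
  have hle := (le_iSup (fun y => ((⟪x, y⟫ : EReal) - F y)) y).trans hC.le
  obtain ⟨v, hv⟩ : ∃ v : ℝ, F y = v :=
    ⟨_, (EReal.coe_toReal (hy.trans_lt (EReal.coe_lt_top lam)).ne (hbot y)).symm⟩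
  simp only [hv] at hle hy
  norm_cast at hle hy
  linarith

/-- A subset of Euclidean space is bounded if every linear functional near `0` is bounded above
on it. -/
lemma EuclideanSpace.isBounded_of_eventually_inner_le {ι : Type*} [Fintype ι]
    {S : Set (EuclideanSpace ℝ ι)}
    (h : ∀ᶠ x in nhds (0 : EuclideanSpace ℝ ι), ∃ C : ℝ, ∀ y ∈ S, ⟪x, y⟫ ≤ C) :
    Bornology.IsBounded S := by
  classical
  obtain ⟨ε, hε, hball⟩ := Metric.eventually_nhds_iff.1 h
  have key (i : ι) (s : ℝ) (hs : |s| < ε) : ∃ C : ℝ, ∀ y ∈ S, s * y i ≤ C := by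
    obtain ⟨C, hC⟩ := hball (y := EuclideanSpace.single i s) (by simpa using hs)
    exact ⟨C, fun y hy => by simpa [EuclideanSpace.inner_single_left, mul_comm] using hC y hy⟩
  have hhalf : |ε / 2| < ε := by rw [abs_of_pos (by positivity)]; linarith
  choose A hA using fun i => key i (ε / 2) hhalf
  choose B hB using fun i => key i (-(ε / 2)) (by rwa [abs_neg])
  refine isBounded_iff_forall_norm_le.2 ⟨∑ i, max (A i) (B i) / (ε / 2), fun y hy => ?_⟩
  have hsum : y = ∑ i, EuclideanSpace.single i (y i) := by
    ext j
    simp [Finset.sum_apply, Pi.single_apply]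
  calc ‖y‖ = ‖∑ i, EuclideanSpace.single i (y i)‖ := by rw [← hsum]
    _ ≤ ∑ i, ‖EuclideanSpace.single i (y i)‖ := norm_sum_le _ _
    _ ≤ _ := by
      refine Finset.sum_le_sum fun i _ => ?_
      rw [PiLp.norm_single, Real.norm_eq_abs, le_div_iff₀ (by positivity)]
      have h1 := (hA i y hy).trans (le_max_left _ (B i))
      have h2 := (hB i y hy).trans (le_max_right (A i) _)
      rcases abs_cases (y i) with ⟨h, -⟩ | ⟨h, -⟩ <;> rw [h] <;> linarith

/-- The conjugate of a function that dominates `M + c * ‖y - y₀‖` is not `⊤` on the ball of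
radius `c`. -/
lemma conjugate_ne_top_of_norm_minorant {E : Type*} [NormedAddCommGroup E]
    [InnerProductSpace ℝ E] {F : E → EReal} {c M : ℝ} {y₀ : E}
    (hF : ∀ y, ((M + c * ‖y - y₀‖ : ℝ) : EReal) ≤ F y) {x : E} (hx : ‖x‖ ≤ c) :
    (⨆ y, ((⟪x, y⟫ : EReal) - F y)) ≠ ⊤ := by
  refine ((iSup_le fun y => ?_).trans_lt (EReal.coe_lt_top (⟪x, y₀⟫ - M))).ne
  refine (EReal.sub_le_sub le_rfl (hF y)).trans ?_
  norm_cast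
  have h1 := real_inner_le_norm x (y - y₀)
  have h2 := mul_le_mul_of_nonneg_right hx (norm_nonneg (y - y₀))
  rw [inner_sub_right] at h1
  linarith

theorem asplund_rockafellar_moreau (n : ℕ)
    (F : EuclideanSpace ℝ (Fin n) → EReal)
    (hbot : ∀ y, F y ≠ ⊥) (htop : ∃ y, F y ≠ ⊤)
    (hconv : ∀ y z : EuclideanSpace ℝ (Fin n), ∀ a b : ℝ, 0 ≤ a → 0 ≤ b → a + b = 1 →
      F (a • y + b • z) ≤ (a : EReal) * F y + (b : EReal) * F z)
    (hlsc : LowerSemicontinuous F) :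
    ((0 : EuclideanSpace ℝ (Fin n)) ∈
        interior {x | (⨆ y, ((⟪x, y⟫ : EReal) - F y)) ≠ ⊤} →
      ∀ lam : ℝ, Bornology.IsBounded {y | F y ≤ (lam : EReal)}) ∧
    (∀ lam : ℝ, (lam : EReal) > ⨅ y, F y →
      ({y | F y ≤ (lam : EReal)}).Nonempty →
      Bornology.IsBounded {y | F y ≤ (lam : EReal)} →
      (0 : EuclideanSpace ℝ (Fin n)) ∈
        interior {x | (⨆ y, ((⟪x, y⟫ : EReal) - F y)) ≠ ⊤}) := by
  refine ⟨fun h lam => ?_, fun lam hlam _ hbdd => ?_⟩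
  · refine EuclideanSpace.isBounded_of_eventually_inner_le ?_
    filter_upwards [mem_interior_iff_mem_nhds.1 h] with x hx
    exact exists_inner_le_of_conjugate_ne_top hbot hx lam
  · obtain ⟨c, hc, M, y₀, hF⟩ :=
      exists_norm_minorant_of_isBounded_sublevel hbot hconv hlsc hlam hbdd
    refine mem_interior_iff_mem_nhds.2 (Filter.mem_of_superset (Metric.ball_mem_nhds _ hc) ?_)
    intro x hx
    exact conjugate_ne_top_of_norm_minorant hF (mem_ball_zero_iff.1 hx).le
end
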